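/- arXiv:2411.16377 — 2 statements merged into one kernel-verified Lean document; each statement's English description precedes it below -/
import Mathlib

section
/- (Properties of the sup-convolution of strictly concave functions.) For i = 0, 1 let Ω_i ⊂ ℝⁿ be an open bounded convex set and let u_i : Ω_i → ℝ be a strictly concave C¹ function with u_i(x) → −∞ as x → ∂Ω_i. Fix t ∈ (0,1), set Ω_t = (1−t)Ω₀ + tΩ₁, and define ũ(z) = sup { (1−t)u₀(x) + t u₁(y) : x ∈ Ω₀, y ∈ Ω₁, z = (1−t)x + t y } for z ∈ Ω_t. Then ũ is a strictly concave C¹ function on Ω_t, and for every z ∈ Ω_t there exists a unique pair (x, y) ∈ Ω₀ × Ω₁ such that z = (1−t)x + t y, ũ(z) = (1−t)u₀(x) + t u₁(y), and ∇ũ(z) = ∇u₀(x) = ∇u₁(y). If moreover u₀ is twice differentiable at x and u₁ at y with negative definite Hessians D²u₀(x), D²u₁(y), then ũ is twice differentiable at z and D²ũ(z) = [ (1−t)(D²u₀(x))^{-1} + t (D²u₁(y))^{-1} ]^{-1}. -/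
open MeasureTheory Real Set Metric Bornology
open scoped RealInnerProductSpace Pointwise NNReal Topology

noncomputable def gaussianMeasure (n : ℕ) : Measure (EuclideanSpace ℝ (Fin n)) :=
  (volume : Measure (EuclideanSpace ℝ (Fin n))).withDensity
    (fun x => ENNReal.ofReal ((2 * π) ^ (-(n : ℝ) / 2) * Real.exp (-‖x‖ ^ 2 / 2)))

/-- `φ` is a smooth compactly supported test function on `Ω`. -/
def IsTestFun (n : ℕ) (Ω : Set (EuclideanSpace ℝ (Fin n)))
    (φ : EuclideanSpace ℝ (Fin n) → ℝ) : Prop :=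
  ContDiff ℝ (⊤ : ℕ∞) φ ∧ HasCompactSupport φ ∧ tsupport φ ⊆ Ω

/-- The first eigenvalue of the Gaussian-weighted `p`-Laplacian on `Ω`. -/
noncomputable def lambdaPGamma (n : ℕ) (p : ℝ) (Ω : Set (EuclideanSpace ℝ (Fin n))) : ℝ :=
  sInf { r : ℝ | ∃ v : EuclideanSpace ℝ (Fin n) → ℝ, IsTestFun n Ω v ∧ v ≠ 0 ∧
    r = (∫ x in Ω, ‖gradient v x‖ ^ p ∂(gaussianMeasure n)) /
        (∫ x in Ω, |v x| ^ p ∂(gaussianMeasure n)) }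

/-- `Ω` has boundary of class `C²`. -/
def HasC2Boundary (n : ℕ) (Ω : Set (EuclideanSpace ℝ (Fin n))) : Prop :=
  ∀ x ∈ frontier Ω, ∃ (U : Set (EuclideanSpace ℝ (Fin n))) (f : EuclideanSpace ℝ (Fin n) → ℝ),
    IsOpen U ∧ x ∈ U ∧ ContDiff ℝ 2 f ∧ (∀ y ∈ U, (y ∈ Ω ↔ f y < 0)) ∧
    (∀ y ∈ U, y ∈ frontier Ω → fderiv ℝ f y ≠ 0)

section helpers
open Filter Asymptotics InnerProductSpace
variable {E : Type*} [NormedAddCommGroup E] [InnerProductSpace ℝ E] [FiniteDimensional ℝ E]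

lemma sc_equiv (H : E →L[ℝ] E) (hH : ∀ h : E, h ≠ 0 → ⟪H h, h⟫ < 0) :
    ∃ e : E ≃L[ℝ] E, H = (e : E →L[ℝ] E) := by
  have hinj : Function.Injective (H : E →ₗ[ℝ] E) := by
    rw [injective_iff_map_eq_zero]
    intro a ha
    by_contra hne
    have h1 := hH a hne
    have h2 : H a = 0 := ha
    rw [h2, inner_zero_left] at h1
    exact lt_irrefl _ h1
  refine ⟨(LinearEquiv.ofInjectiveEndo (H : E →ₗ[ℝ] E) hinj).toContinuousLinearEquiv, ?_⟩
  ext x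
  rfl

lemma sc_equiv_symm (e : E ≃L[ℝ] E) (hH : ∀ h : E, h ≠ 0 → ⟪e h, h⟫ < 0) :
    ∀ h : E, h ≠ 0 → ⟪e.symm h, h⟫ < 0 := by
  intro h hh
  have h1 := hH (e.symm h) (by simpa using hh)
  rw [e.apply_symm_apply, real_inner_comm] at h1
  exact h1

lemma sc_asymp {α : Type*} {l : Filter α} (e : E ≃L[ℝ] E) {a b : α → E}
    (h : (fun i => a i - e (b i)) =o[l] b) : (fun i => b i - e.symm (a i)) =o[l] a := by
  have h1 : (fun i => b i - e.symm (a i)) =o[l] b := by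
    have := (ContinuousLinearMap.isBigO_comp (e.symm : E →L[ℝ] E) (fun i => a i - e (b i)) l).trans_isLittleO h
    refine this.neg_left.congr_left fun i => ?_
    simp
  have h2 : b =O[l] fun i => e.symm (a i) := by
    simpa using h1.right_isBigO_sub
  have h3 : (fun i => e.symm (a i)) =O[l] a :=
    ContinuousLinearMap.isBigO_comp (e.symm : E →L[ℝ] E) a l
  exact h1.trans_isBigO (h2.trans h3)

lemma sc_tangent_le {Ω : Set E} {u : E → ℝ} (hc : ConcaveOn ℝ Ω u) {x x' p : E}
    (hx : x ∈ Ω) (hx' : x' ∈ Ω) (hp : HasGradientAt u p x) :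
    u x' ≤ u x + ⟪p, x' - x⟫ := by
  have h1 := hc.comp_affineMap (AffineMap.lineMap x x' : ℝ →ᵃ[ℝ] E)
  have h2 : HasDerivAt (u ∘ (AffineMap.lineMap x x' : ℝ →ᵃ[ℝ] E)) ⟪p, x' - x⟫ 0 := by
    have h3 : HasDerivAt (AffineMap.lineMap x x' : ℝ →ᵃ[ℝ] E) (x' - x) (0 : ℝ) :=
      AffineMap.hasDerivAt_lineMap
    have h4 : HasFDerivAt u (toDual ℝ E p) ((AffineMap.lineMap x x' : ℝ →ᵃ[ℝ] E) (0:ℝ)) := by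
      rw [AffineMap.lineMap_apply_zero]; exact hp.hasFDerivAt
    simpa using h4.comp_hasDerivAt (0 : ℝ) h3
  have h5 := h1.slope_le_of_hasDerivAt (x := 0) (y := 1) (by simpa using hx) (by simpa using hx')
    one_pos h2
  simp [slope_def_field] at h5
  linarith

lemma sc_tangent_lt {Ω : Set E} {u : E → ℝ} (hc : StrictConcaveOn ℝ Ω u) {x x' p : E}
    (hx : x ∈ Ω) (hx' : x' ∈ Ω) (hp : HasGradientAt u p x) (hne : x' ≠ x) :
    u x' < u x + ⟪p, x' - x⟫ := by
  have h1 := hc.2 hx hx' hne.symm (show (0:ℝ) < 1/2 by norm_num) (show (0:ℝ) < 1/2 by norm_num)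
    (by norm_num)
  have hm : (1/2 : ℝ) • x + (1/2 : ℝ) • x' ∈ Ω :=
    hc.1 hx hx' (by norm_num) (by norm_num) (by norm_num)
  have h2 := sc_tangent_le hc.concaveOn hx hm hp
  have h3 : (1/2 : ℝ) • x + (1/2 : ℝ) • x' - x = (1/2 : ℝ) • (x' - x) := by module
  rw [h3, inner_smul_right] at h2
  simp only [smul_eq_mul] at h1
  linarith

lemma sc_bdd {Ω : Set E} {u : E → ℝ} (hu : ContinuousOn u Ω)
    (hlim : ∀ M : ℝ, ∃ K : Set E, IsCompact K ∧ K ⊆ Ω ∧ ∀ x ∈ Ω \ K, u x < -M) :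
    ∃ B : ℝ, ∀ x ∈ Ω, u x ≤ B := by
  obtain ⟨K, hK, hKs, h⟩ := hlim 0
  obtain ⟨B, hB⟩ := hK.bddAbove_image (hu.mono hKs)
  refine ⟨max B 0, fun x hx => ?_⟩
  by_cases hxK : x ∈ K
  · exact le_max_of_le_left (hB ⟨x, hxK, rfl⟩)
  · have := h x ⟨hx, hxK⟩
    exact le_max_of_le_right (by linarith)

lemma sc_contain {t : ℝ} (ht : t ∈ Set.Ioo (0 : ℝ) 1) {Ω₀ Ω₁ : Set E} {u₀ u₁ : E → ℝ}
    (hu₀ : ContinuousOn u₀ Ω₀) (hu₁ : ContinuousOn u₁ Ω₁)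
    (hlim₀ : ∀ M : ℝ, ∃ K : Set E, IsCompact K ∧ K ⊆ Ω₀ ∧ ∀ x ∈ Ω₀ \ K, u₀ x < -M)
    (hlim₁ : ∀ M : ℝ, ∃ K : Set E, IsCompact K ∧ K ⊆ Ω₁ ∧ ∀ x ∈ Ω₁ \ K, u₁ x < -M) (c : ℝ) :
    ∃ K₀ K₁ : Set E, IsCompact K₀ ∧ IsCompact K₁ ∧ K₀ ⊆ Ω₀ ∧ K₁ ⊆ Ω₁ ∧
      ∀ x ∈ Ω₀, ∀ y ∈ Ω₁, c ≤ (1 - t) * u₀ x + t * u₁ y → x ∈ K₀ ∧ y ∈ K₁ := by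
  obtain ⟨t0, t1⟩ := ht
  have t1' : 0 < 1 - t := by linarith
  obtain ⟨B₀, hB₀⟩ := sc_bdd hu₀ hlim₀
  obtain ⟨B₁, hB₁⟩ := sc_bdd hu₁ hlim₁
  obtain ⟨K₀, hK₀, hs₀, h₀⟩ := hlim₀ (-((c - t * B₁) / (1 - t)))
  obtain ⟨K₁, hK₁, hs₁, h₁⟩ := hlim₁ (-((c - (1 - t) * B₀) / t))
  refine ⟨K₀, K₁, hK₀, hK₁, hs₀, hs₁, fun x hx y hy hc => ⟨?_, ?_⟩⟩
  · by_contra hn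
    have h := h₀ x ⟨hx, hn⟩
    rw [neg_neg, lt_div_iff₀ t1'] at h
    have := mul_le_mul_of_nonneg_left (hB₁ y hy) t0.le
    linarith
  · by_contra hn
    have h := h₁ y ⟨hy, hn⟩
    rw [neg_neg, lt_div_iff₀ t0] at h
    have := mul_le_mul_of_nonneg_left (hB₀ x hx) t1'.le
    linarith

lemma sc_grad {Ω : Set E} {u : E → ℝ} (hΩ : IsOpen Ω) (hu : ContDiffOn ℝ 1 u Ω) {x : E}
    (hx : x ∈ Ω) : HasGradientAt u (gradient u x) x :=
  ((hu.differentiableOn one_ne_zero).differentiableAt (hΩ.mem_nhds hx)).hasGradientAt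

lemma sc_grad_cont {Ω : Set E} {u : E → ℝ} (hΩ : IsOpen Ω) (hu : ContDiffOn ℝ 1 u Ω) {x : E}
    (hx : x ∈ Ω) : ContinuousAt (gradient u) x := by
  have h := (hu.continuousOn_fderiv_of_isOpen hΩ le_rfl).continuousAt (hΩ.mem_nhds hx)
  exact (toDual ℝ E).symm.continuous.continuousAt.comp h

/-- existence of a critical decomposition -/
lemma sc_exists {t : ℝ} (ht : t ∈ Set.Ioo (0 : ℝ) 1) {Ω₀ Ω₁ : Set E} {u₀ u₁ : E → ℝ}
    (h₀o : IsOpen Ω₀) (h₁o : IsOpen Ω₁)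
    (hu₀ : ContDiffOn ℝ 1 u₀ Ω₀) (hu₁ : ContDiffOn ℝ 1 u₁ Ω₁)
    (hlim₀ : ∀ M : ℝ, ∃ K : Set E, IsCompact K ∧ K ⊆ Ω₀ ∧ ∀ x ∈ Ω₀ \ K, u₀ x < -M)
    (hlim₁ : ∀ M : ℝ, ∃ K : Set E, IsCompact K ∧ K ⊆ Ω₁ ∧ ∀ x ∈ Ω₁ \ K, u₁ x < -M)
    {z : E} (hz : z ∈ (1 - t) • Ω₀ + t • Ω₁) :
    ∃ x y, x ∈ Ω₀ ∧ y ∈ Ω₁ ∧ z = (1 - t) • x + t • y ∧ gradient u₀ x = gradient u₁ y := by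
  obtain ⟨_, ⟨x0, hx0, rfl⟩, _, ⟨y0, hy0, rfl⟩, hz⟩ := hz
  simp only at hz
  obtain ⟨K₀, K₁, hK₀, hK₁, hs₀, hs₁, hK⟩ := sc_contain ht hu₀.continuousOn hu₁.continuousOn
    hlim₀ hlim₁ ((1 - t) * u₀ x0 + t * u₁ y0)
  obtain ⟨t0, t1⟩ := ht
  have t1' : 0 < 1 - t := by linarith
  let C : Set (E × E) := (K₀ ×ˢ K₁) ∩ {q | (1 - t) • q.1 + t • q.2 = z}
  have hC : IsCompact C := (hK₀.prod hK₁).inter_right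
    (isClosed_eq (by fun_prop) (by fun_prop))
  have hF : ContinuousOn (fun q : E × E => (1 - t) * u₀ q.1 + t * u₁ q.2) C := by
    have a : ContinuousOn (fun q : E × E => u₀ q.1) C :=
      hu₀.continuousOn.comp continuousOn_fst (fun q hq => hs₀ hq.1.1)
    have b : ContinuousOn (fun q : E × E => u₁ q.2) C :=
      hu₁.continuousOn.comp continuousOn_snd (fun q hq => hs₁ hq.1.2)
    exact (a.const_mul _).add (b.const_mul _)
  have hne : (x0, y0) ∈ C := ⟨hK x0 hx0 y0 hy0 le_rfl, hz⟩
  obtain ⟨⟨x, y⟩, hq, hmax⟩ := hC.exists_isMaxOn ⟨_, hne⟩ hF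
  have hx : x ∈ Ω₀ := hs₀ hq.1.1
  have hy : y ∈ Ω₁ := hs₁ hq.1.2
  have hxy : (1 - t) • x + t • y = z := hq.2
  have hmax' : ∀ x' ∈ Ω₀, ∀ y' ∈ Ω₁, (1 - t) • x' + t • y' = z →
      (1 - t) * u₀ x' + t * u₁ y' ≤ (1 - t) * u₀ x + t * u₁ y := by
    intro x' hx' y' hy' h
    have h0 : (1 - t) * u₀ x0 + t * u₁ y0 ≤ (1 - t) * u₀ x + t * u₁ y := hmax hne
    by_cases hle : (1 - t) * u₀ x0 + t * u₁ y0 ≤ (1 - t) * u₀ x' + t * u₁ y'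
    · have : (x', y') ∈ C := ⟨hK x' hx' y' hy' hle, h⟩
      exact hmax this
    · exact (not_le.1 hle).le.trans h0
  refine ⟨x, y, hx, hy, hxy.symm, ?_⟩
  have hd0 : HasFDerivAt (fun h : E => x + t • h) (t • ContinuousLinearMap.id ℝ E) 0 :=
    ((hasFDerivAt_id (0 : E)).const_smul t).const_add x
  have hd1 : HasFDerivAt (fun h : E => y - (1 - t) • h) (-((1 - t) • ContinuousLinearMap.id ℝ E)) 0 :=
    ((hasFDerivAt_id (0 : E)).const_smul (1 - t)).const_sub y
  have g0 : HasFDerivAt u₀ (toDual ℝ E (gradient u₀ x)) (x + t • (0 : E)) := by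
    rw [smul_zero, add_zero]; exact (sc_grad h₀o hu₀ hx).hasFDerivAt
  have g1 : HasFDerivAt u₁ (toDual ℝ E (gradient u₁ y)) (y - (1 - t) • (0 : E)) := by
    rw [smul_zero, sub_zero]; exact (sc_grad h₁o hu₁ hy).hasFDerivAt
  have hd := ((g0.comp (0 : E) hd0).const_mul (1 - t)).add ((g1.comp (0 : E) hd1).const_mul t)
  have e0 : ∀ᶠ h in 𝓝 (0 : E), x + t • h ∈ Ω₀ :=
    hd0.continuousAt.eventually_mem (h₀o.mem_nhds (by simpa using hx))
  have e1 : ∀ᶠ h in 𝓝 (0 : E), y - (1 - t) • h ∈ Ω₁ :=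
    hd1.continuousAt.eventually_mem (h₁o.mem_nhds (by simpa using hy))
  have hloc : IsLocalMax (fun h : E => (1 - t) * u₀ (x + t • h) + t * u₁ (y - (1 - t) • h)) 0 := by
    filter_upwards [e0, e1] with h h0 h1
    have := hmax' _ h0 _ h1 (by rw [← hxy]; module)
    simpa using this
  have hzero := hloc.hasFDerivAt_eq_zero hd
  have h2 := congrArg (fun L : E →L[ℝ] ℝ => L (gradient u₀ x - gradient u₁ y)) hzero
  simp only [_root_.add_apply, _root_.smul_apply,
    ContinuousLinearMap.comp_apply, _root_.neg_apply, ContinuousLinearMap.id_apply,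
    toDual_apply_apply, inner_neg_right, inner_smul_right, smul_eq_mul,
    _root_.zero_apply] at h2
  have h3 : ((1 - t) * t) * ⟪gradient u₀ x - gradient u₁ y, gradient u₀ x - gradient u₁ y⟫ = 0 := by
    rw [inner_sub_left]; linarith
  rcases mul_eq_zero.1 h3 with h | h
  · exact absurd h (mul_pos t1' t0).ne'
  · exact sub_eq_zero.1 (inner_self_eq_zero.1 h)


lemma sc_strict {t : ℝ} (ht : t ∈ Set.Ioo (0 : ℝ) 1) {Ω₀ Ω₁ : Set E} {u₀ u₁ : E → ℝ}
    (h₀o : IsOpen Ω₀) (h₁o : IsOpen Ω₁)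
    (hu₀ : ContDiffOn ℝ 1 u₀ Ω₀) (hu₁ : ContDiffOn ℝ 1 u₁ Ω₁)
    (hc₀ : StrictConcaveOn ℝ Ω₀ u₀) (hc₁ : StrictConcaveOn ℝ Ω₁ u₁)
    {x y x' y' : E} (hx : x ∈ Ω₀) (hy : y ∈ Ω₁) (hx' : x' ∈ Ω₀) (hy' : y' ∈ Ω₁)
    (hp : gradient u₀ x = gradient u₁ y) (hne : ¬ (x' = x ∧ y' = y)) :
    (1 - t) * u₀ x' + t * u₁ y' < (1 - t) * u₀ x + t * u₁ y +
      ⟪gradient u₀ x, ((1 - t) • x' + t • y') - ((1 - t) • x + t • y)⟫ := by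
  obtain ⟨t0, t1⟩ := ht
  have t1' : 0 < 1 - t := by linarith
  have g0 := sc_grad h₀o hu₀ hx
  have g1 := sc_grad h₁o hu₁ hy
  rw [← hp] at g1
  have l0 := sc_tangent_le hc₀.concaveOn hx hx' g0
  have l1 := sc_tangent_le hc₁.concaveOn hy hy' g1
  have e : ((1 - t) • x' + t • y') - ((1 - t) • x + t • y) = (1 - t) • (x' - x) + t • (y' - y) := by
    module
  rw [e, inner_add_right, inner_smul_right, inner_smul_right]
  have m0 := mul_le_mul_of_nonneg_left l0 t1'.le
  have m1 := mul_le_mul_of_nonneg_left l1 t0.le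
  by_cases hxx : x' = x
  · have hyy : y' ≠ y := fun h => hne ⟨hxx, h⟩
    have m1' := mul_lt_mul_of_pos_left (sc_tangent_lt hc₁ hy hy' g1 hyy) t0
    linarith
  · have m0' := mul_lt_mul_of_pos_left (sc_tangent_lt hc₀ hx hx' g0 hxx) t1'
    linarith

lemma sc_main
    (t : ℝ) (ht : t ∈ Set.Ioo (0 : ℝ) 1)
    (Ω₀ Ω₁ : Set E)
    (h₀o : IsOpen Ω₀) (h₀c : Convex ℝ Ω₀)
    (h₁o : IsOpen Ω₁) (h₁c : Convex ℝ Ω₁)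
    (u₀ u₁ : E → ℝ)
    (hu₀1 : ContDiffOn ℝ 1 u₀ Ω₀) (hu₀cc : StrictConcaveOn ℝ Ω₀ u₀)
    (hu₀lim : ∀ M : ℝ, ∃ K : Set E,
      IsCompact K ∧ K ⊆ Ω₀ ∧ ∀ x ∈ Ω₀ \ K, u₀ x < -M)
    (hu₁1 : ContDiffOn ℝ 1 u₁ Ω₁) (hu₁cc : StrictConcaveOn ℝ Ω₁ u₁)
    (hu₁lim : ∀ M : ℝ, ∃ K : Set E,
      IsCompact K ∧ K ⊆ Ω₁ ∧ ∀ x ∈ Ω₁ \ K, u₁ x < -M)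
    (Ωt : Set E) (hΩt : Ωt = (1 - t) • Ω₀ + t • Ω₁)
    (ut : E → ℝ)
    (hut : ∀ z, ut z = sSup {s : ℝ | ∃ x ∈ Ω₀, ∃ y ∈ Ω₁,
      z = (1 - t) • x + t • y ∧ s = (1 - t) * u₀ x + t * u₁ y}) :
    ContDiffOn ℝ 1 ut Ωt ∧ StrictConcaveOn ℝ Ωt ut ∧
    (∀ z ∈ Ωt, ∃! q : E × E,
      q.1 ∈ Ω₀ ∧ q.2 ∈ Ω₁ ∧ z = (1 - t) • q.1 + t • q.2 ∧
      ut z = (1 - t) * u₀ q.1 + t * u₁ q.2 ∧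
      gradient ut z = gradient u₀ q.1 ∧ gradient u₀ q.1 = gradient u₁ q.2) ∧
    (∀ z ∈ Ωt, ∀ x ∈ Ω₀, ∀ y ∈ Ω₁,
      z = (1 - t) • x + t • y →
      ut z = (1 - t) * u₀ x + t * u₁ y →
      gradient ut z = gradient u₀ x → gradient u₀ x = gradient u₁ y →
      ∀ H₀ H₁ : E →L[ℝ] E,
        HasFDerivAt (fun w => gradient u₀ w) H₀ x →
        (∀ h : E, h ≠ 0 → ⟪H₀ h, h⟫ < 0) →
        HasFDerivAt (fun w => gradient u₁ w) H₁ y →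
        (∀ h : E, h ≠ 0 → ⟪H₁ h, h⟫ < 0) →
        HasFDerivAt (fun w => gradient ut w)
          (((1 - t) • H₀.inverse + t • H₁.inverse).inverse) z) := by
  have key : ∀ z, z ∈ Ωt → ∃ x y, x ∈ Ω₀ ∧ y ∈ Ω₁ ∧ z = (1 - t) • x + t • y ∧
      gradient u₀ x = gradient u₁ y := by
    intro z hz
    rw [hΩt] at hz
    exact sc_exists ht h₀o h₁o hu₀1 hu₁1 hu₀lim hu₁lim hz
  have hstrict : ∀ {x y x' y' : E}, x ∈ Ω₀ → y ∈ Ω₁ → x' ∈ Ω₀ → y' ∈ Ω₁ →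
      gradient u₀ x = gradient u₁ y → ¬ (x' = x ∧ y' = y) →
      (1 - t) * u₀ x' + t * u₁ y' < (1 - t) * u₀ x + t * u₁ y +
      ⟪gradient u₀ x, ((1 - t) • x' + t • y') - ((1 - t) • x + t • y)⟫ :=
    fun hx hy hx' hy' hp hne =>
      sc_strict ht h₀o h₁o hu₀1 hu₁1 hu₀cc hu₁cc hx hy hx' hy' hp hne
  have hbd := sc_contain ht hu₀1.continuousOn hu₁1.continuousOn hu₀lim hu₁lim
  obtain ⟨t0, t1⟩ := ht
  have t1' : 0 < 1 - t := by linarith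
  have hopen : IsOpen Ωt := by
    rw [hΩt]; exact (h₁o.smul₀ t0.ne').add_left
  have hmem : ∀ {x y : E}, x ∈ Ω₀ → y ∈ Ω₁ → (1 - t) • x + t • y ∈ Ωt := by
    intro x y hx hy
    rw [hΩt]
    exact Set.add_mem_add (Set.smul_mem_smul_set hx) (Set.smul_mem_smul_set hy)
  -- value at critical pairs
  have hval : ∀ {x y : E}, x ∈ Ω₀ → y ∈ Ω₁ → gradient u₀ x = gradient u₁ y →
      ut ((1 - t) • x + t • y) = (1 - t) * u₀ x + t * u₁ y := by
    intro x y hx hy hp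
    rw [hut]
    apply IsGreatest.csSup_eq
    refine ⟨⟨x, hx, y, hy, rfl, rfl⟩, ?_⟩
    rintro s ⟨x', hx', y', hy', hz, rfl⟩
    by_cases h : x' = x ∧ y' = y
    · rw [h.1, h.2]
    · have := hstrict hx hy hx' hy' hp h
      rw [← hz, sub_self, inner_zero_right, add_zero] at this
      exact this.le
  -- uniqueness of critical pairs
  have huniq : ∀ {x y x' y' : E}, x ∈ Ω₀ → y ∈ Ω₁ → x' ∈ Ω₀ → y' ∈ Ω₁ →
      gradient u₀ x = gradient u₁ y → gradient u₀ x' = gradient u₁ y' →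
      (1 - t) • x' + t • y' = (1 - t) • x + t • y → x' = x ∧ y' = y := by
    intro x y x' y' hx hy hx' hy' hp hp' hz
    by_contra hne
    have h1 := hstrict hx hy hx' hy' hp hne
    rw [← hval hx hy hp, ← hval hx' hy' hp', hz, sub_self, inner_zero_right, add_zero] at h1
    exact lt_irrefl _ h1
  have hge : ∀ {x y : E}, x ∈ Ω₀ → y ∈ Ω₁ →
      (1 - t) * u₀ x + t * u₁ y ≤ ut ((1 - t) • x + t • y) := by
    intro x y hx hy
    obtain ⟨x', y', hx', hy', hz, hp⟩ := key _ (hmem hx hy)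
    rw [hz, hval hx' hy' hp]
    by_cases h : x = x' ∧ y = y'
    · rw [h.1, h.2]
    · have := hstrict hx' hy' hx hy hp h
      rw [← hz, sub_self, inner_zero_right, add_zero] at this
      exact this.le
  choose! X Y hX hY hz hp using key
  have hvalz : ∀ z ∈ Ωt, ut z = (1 - t) * u₀ (X z) + t * u₁ (Y z) := by
    intro z hzt
    conv_lhs => rw [hz z hzt]
    exact hval (hX z hzt) (hY z hzt) (hp z hzt)
  have hsup : ∀ z ∈ Ωt, ∀ w ∈ Ωt, w ≠ z → ut w < ut z + ⟪gradient u₀ (X z), w - z⟫ := by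
    intro z hzt w hwt hne
    have h1 := hstrict (hX z hzt) (hY z hzt) (hX w hwt) (hY w hwt) (hp z hzt) (by
      rintro ⟨h1, h2⟩
      exact hne (by rw [hz z hzt, hz w hwt, h1, h2]))
    rw [← hz z hzt, ← hz w hwt, ← hvalz z hzt, ← hvalz w hwt] at h1
    exact h1
  have hgrad : ∀ z ∈ Ωt, HasGradientAt ut (gradient u₀ (X z)) z := by
    intro z hzt
    have g0 := sc_grad h₀o hu₀1 (hX z hzt)
    have g1 := sc_grad h₁o hu₁1 (hY z hzt)
    rw [← hp z hzt] at g1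
    rw [hasGradientAt_iff_isLittleO_nhds_zero] at g0 g1 ⊢
    have hlow := (g0.const_mul_left (1 - t)).add (g1.const_mul_left t)
    refine IsBigO.trans_isLittleO (IsBigO.of_bound 1 ?_) hlow
    have e0 : ∀ᶠ h in 𝓝 (0 : E), X z + h ∈ Ω₀ :=
      (continuous_const.add continuous_id).continuousAt.eventually_mem
        (h₀o.mem_nhds (by simpa using hX z hzt))
    have e1 : ∀ᶠ h in 𝓝 (0 : E), Y z + h ∈ Ω₁ :=
      (continuous_const.add continuous_id).continuousAt.eventually_mem
        (h₁o.mem_nhds (by simpa using hY z hzt))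
    filter_upwards [e0, e1] with h h0 h1
    have e : (1 - t) • (X z + h) + t • (Y z + h) = z + h := by
      conv_rhs => rw [hz z hzt]
      module
    have a1 := hge h0 h1
    have a2 := hmem h0 h1
    rw [e] at a1 a2
    have a3 : ut (z + h) ≤ ut z + ⟪gradient u₀ (X z), h⟫ := by
      by_cases hh : h = 0
      · simp [hh]
      · have := hsup z hzt _ a2 (by simpa using hh)
        rw [add_sub_cancel_left] at this
        exact this.le
    have a4 := hvalz z hzt
    rw [one_mul, Real.norm_eq_abs, Real.norm_eq_abs, abs_of_nonpos (by linarith),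
      abs_of_nonpos (by nlinarith)]
    nlinarith
  -- continuity of the pair
  have hcont : ∀ z ∈ Ωt, Tendsto (fun w => (X w, Y w)) (𝓝 z) (𝓝 (X z, Y z)) := by
    intro z hzt
    have evt : ∀ᶠ w in 𝓝 z, w ∈ Ωt := hopen.mem_nhds hzt
    obtain ⟨K₀, K₁, hK₀, hK₁, hs₀, hs₁, hK⟩ := hbd (ut z - 1)
    have evl : ∀ᶠ w in 𝓝 z, ut z - 1 < ut w :=
      (hgrad z hzt).differentiableAt.continuousAt.eventually_const_lt (by linarith)
    refine (hK₀.prod hK₁).tendsto_nhds_of_unique_mapClusterPt ?_ ?_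
    · filter_upwards [evt, evl] with w hw hl
      exact hK _ (hX w hw) _ (hY w hw) (by rw [← hvalz w hw]; exact hl.le)
    · rintro ⟨x, y⟩ ⟨hx, hy⟩ hcl
      have hx : x ∈ Ω₀ := hs₀ hx
      have hy : y ∈ Ω₁ := hs₁ hy
      have c1 : MapClusterPt ((1 - t) • x + t • y) (𝓝 z)
          ((fun q : E × E => (1 - t) • q.1 + t • q.2) ∘ fun w => (X w, Y w)) :=
        hcl.continuousAt_comp (f := fun q : E × E => (1 - t) • q.1 + t • q.2)
          (by fun_prop)
      have c2 : MapClusterPt ((1 - t) • x + t • y) (𝓝 z) id := by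
        refine (Filter.EventuallyEq.mapClusterPt_iff ?_).1 c1
        filter_upwards [evt] with w hw
        exact (hz w hw).symm
      have c3 : (1 - t) • x + t • y = z := by
        rw [mapClusterPt_id_iff] at c2
        exact eq_of_nhds_neBot c2
      have d0 : ContinuousAt (fun q : E × E => gradient u₀ q.1 - gradient u₁ q.2) (x, y) := by
        refine ContinuousAt.sub ?_ ?_
        · exact ContinuousAt.comp (f := Prod.fst) (x := (x, y)) (sc_grad_cont h₀o hu₀1 hx)
            continuousAt_fst
        · exact ContinuousAt.comp (f := Prod.snd) (x := (x, y)) (sc_grad_cont h₁o hu₁1 hy)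
            continuousAt_snd
      have d1 := hcl.continuousAt_comp d0
      have d2 : gradient u₀ x - gradient u₁ y ∈ ({0} : Set E) := by
        refine isClosed_singleton.mem_of_mapClusterPt d1 ?_
        filter_upwards [evt] with w hw
        simp [hp w hw]
      have d3 : gradient u₀ x = gradient u₁ y := sub_eq_zero.1 d2
      obtain ⟨r1, r2⟩ := huniq (hX z hzt) (hY z hzt) hx hy (hp z hzt) d3
        (c3.trans (hz z hzt))
      rw [r1, r2]
  have hcX : ∀ z ∈ Ωt, ContinuousAt X z := fun z hzt => (hcont z hzt).fst_nhds
  have hcY : ∀ z ∈ Ωt, ContinuousAt Y z := fun z hzt => (hcont z hzt).snd_nhds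
  refine ⟨?_, ⟨?_, ?_⟩, ?_, ?_⟩
  · have : ContDiffOn ℝ (0 + 1) ut Ωt := by
      rw [contDiffOn_succ_iff_fderiv_of_isOpen hopen]
      refine ⟨fun z hzt => (hgrad z hzt).differentiableAt.differentiableWithinAt, by simp, ?_⟩
      rw [contDiffOn_zero]
      intro z hzt
      have h1 : ContinuousAt (fun w => toDual ℝ E (gradient u₀ (X w))) z :=
        (toDual ℝ E).continuous.continuousAt.comp
          ((sc_grad_cont h₀o hu₀1 (hX z hzt)).comp (hcX z hzt))
      refine h1.continuousWithinAt.congr ?_ ?_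
      · intro w hw
        exact (hgrad w hw).hasFDerivAt.fderiv
      · exact (hgrad z hzt).hasFDerivAt.fderiv
    simpa using this
  · rw [hΩt]
    exact (h₀c.smul _).add (h₁c.smul _)
  · intro c hc d hd hcd a b ha hb hab
    have hm : a • c + b • d ∈ Ωt := by
      have : Convex ℝ Ωt := by rw [hΩt]; exact (h₀c.smul _).add (h₁c.smul _)
      exact this hc hd ha.le hb.le hab
    have hb' : b = 1 - a := by linarith
    have n1 : c - (a • c + b • d) = b • (c - d) := by rw [hb']; module
    have n2 : d - (a • c + b • d) = -(a • (c - d)) := by rw [hb']; module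
    have hcd' := sub_ne_zero.2 hcd
    have s1 := hsup _ hm c hc (by
      rw [← sub_ne_zero, n1]; exact smul_ne_zero hb.ne' hcd')
    have s2 := hsup _ hm d hd (by
      rw [← sub_ne_zero, n2]; exact neg_ne_zero.2 (smul_ne_zero ha.ne' hcd'))
    rw [n1, inner_smul_right] at s1
    rw [n2, inner_neg_right, inner_smul_right] at s2
    have s1' := mul_lt_mul_of_pos_left s1 ha
    have s2' := mul_lt_mul_of_pos_left s2 hb
    simp only [smul_eq_mul]
    have : ut (a • c + b • d) = a * ut (a • c + b • d) + b * ut (a • c + b • d) := by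
      rw [← add_mul, hab, one_mul]
    rw [this]
    linarith
  · intro z hzt
    refine ⟨(X z, Y z), ⟨hX z hzt, hY z hzt, hz z hzt, hvalz z hzt, (hgrad z hzt).gradient,
      hp z hzt⟩, ?_⟩
    rintro ⟨x, y⟩ ⟨hx, hy, hzz, -, -, hpp⟩
    obtain ⟨r1, r2⟩ := huniq (hX z hzt) (hY z hzt) hx hy (hp z hzt) hpp
      (hzz.symm.trans (hz z hzt))
    exact Prod.ext r1 r2
  · intro z hzt x hx y hy hzz _ _ hpp H₀ H₁ hH₀ hn₀ hH₁ hn₁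
    obtain ⟨r1, r2⟩ := huniq (hX z hzt) (hY z hzt) hx hy (hp z hzt) hpp
      (hzz.symm.trans (hz z hzt))
    subst r1 r2
    obtain ⟨e₀, rfl⟩ := sc_equiv H₀ hn₀
    obtain ⟨e₁, rfl⟩ := sc_equiv H₁ hn₁
    have m₀ := sc_equiv_symm e₀ hn₀
    have m₁ := sc_equiv_symm e₁ hn₁
    rw [ContinuousLinearMap.inverse_equiv, ContinuousLinearMap.inverse_equiv]
    obtain ⟨A, hA⟩ := sc_equiv ((1 - t) • (e₀.symm : E →L[ℝ] E) + t • (e₁.symm : E →L[ℝ] E)) (by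
      intro h hh
      have a0 := mul_neg_of_pos_of_neg t1' (m₀ h hh)
      have a1 := mul_neg_of_pos_of_neg t0 (m₁ h hh)
      simp only [_root_.add_apply, _root_.smul_apply, inner_add_left, real_inner_smul_left,
        ContinuousLinearEquiv.coe_coe]
      linarith)
    rw [hA, ContinuousLinearMap.inverse_equiv]
    have evt : ∀ᶠ w in 𝓝 z, w ∈ Ωt := hopen.mem_nhds hzt
    have b0 : (fun w => (gradient ut w - gradient ut z) - e₀ (X w - X z)) =o[𝓝 z]
        (fun w => X w - X z) := by
      refine (hH₀.isLittleO.comp_tendsto (hcX z hzt)).congr' ?_ EventuallyEq.rfl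
      filter_upwards [evt] with w hw
      simp [(hgrad w hw).gradient, (hgrad z hzt).gradient]
    have b1 : (fun w => (gradient ut w - gradient ut z) - e₁ (Y w - Y z)) =o[𝓝 z]
        (fun w => Y w - Y z) := by
      refine (hH₁.isLittleO.comp_tendsto (hcY z hzt)).congr' ?_ EventuallyEq.rfl
      filter_upwards [evt] with w hw
      simp [(hgrad w hw).gradient, (hgrad z hzt).gradient, hp w hw, hp z hzt]
    have c0 := sc_asymp e₀ b0
    have c1 := sc_asymp e₁ b1
    have c2 : (fun w => (w - z) - A (gradient ut w - gradient ut z)) =o[𝓝 z]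
        (fun w => gradient ut w - gradient ut z) := by
      refine ((c0.const_smul_left (1 - t)).add (c1.const_smul_left t)).congr' ?_ EventuallyEq.rfl
      filter_upwards [evt] with w hw
      have hAv : ∀ v, A v = (1 - t) • e₀.symm v + t • e₁.symm v := by
        intro v
        have := congrArg (fun L : E →L[ℝ] E => L v) hA
        simpa using this.symm
      have hzw : w - z = (1 - t) • (X w - X z) + t • (Y w - Y z) := by
        conv_lhs => rw [hz z hzt, hz w hw]
        module
      rw [hAv, hzw]
      simp only [Pi.smul_apply]
      module
    exact .of_isLittleO (sc_asymp A c2)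

end helpers

/-- **Properties of the sup-convolution (infimal convolution of convex functions)**
(Lemma 5.1, i.e. Lemma 2.1 of Colesanti–Salani): the sup-convolution `ũ` of two strictly
concave `C¹` functions `u₀, u₁` tending to `-∞` at the boundary is a strictly concave
`C¹` function on the Minkowski combination `Ω_t`; every `z ∈ Ω_t` has a unique
decomposition `z = (1-t)x + ty` realizing the supremum, at which the three gradients
agree; and at points of twice differentiability with negative definite Hessians, `ũ` is
twice differentiable with `D²ũ(z) = [(1-t)(D²u₀(x))⁻¹ + t(D²u₁(y))⁻¹]⁻¹`. -/
theorem sup_convolution_properties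
    (n : ℕ) (t : ℝ) (ht : t ∈ Set.Ioo (0 : ℝ) 1)
    (Ω₀ Ω₁ : Set (EuclideanSpace ℝ (Fin n)))
    (h₀o : IsOpen Ω₀) (h₀b : IsBounded Ω₀) (h₀c : Convex ℝ Ω₀)
    (h₁o : IsOpen Ω₁) (h₁b : IsBounded Ω₁) (h₁c : Convex ℝ Ω₁)
    (u₀ u₁ : EuclideanSpace ℝ (Fin n) → ℝ)
    (hu₀1 : ContDiffOn ℝ 1 u₀ Ω₀) (hu₀cc : StrictConcaveOn ℝ Ω₀ u₀)
    (hu₀lim : ∀ M : ℝ, ∃ K : Set (EuclideanSpace ℝ (Fin n)),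
      IsCompact K ∧ K ⊆ Ω₀ ∧ ∀ x ∈ Ω₀ \ K, u₀ x < -M)
    (hu₁1 : ContDiffOn ℝ 1 u₁ Ω₁) (hu₁cc : StrictConcaveOn ℝ Ω₁ u₁)
    (hu₁lim : ∀ M : ℝ, ∃ K : Set (EuclideanSpace ℝ (Fin n)),
      IsCompact K ∧ K ⊆ Ω₁ ∧ ∀ x ∈ Ω₁ \ K, u₁ x < -M)
    (Ωt : Set (EuclideanSpace ℝ (Fin n))) (hΩt : Ωt = (1 - t) • Ω₀ + t • Ω₁)
    (ut : EuclideanSpace ℝ (Fin n) → ℝ)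
    (hut : ∀ z, ut z = sSup {s : ℝ | ∃ x ∈ Ω₀, ∃ y ∈ Ω₁,
      z = (1 - t) • x + t • y ∧ s = (1 - t) * u₀ x + t * u₁ y}) :
    ContDiffOn ℝ 1 ut Ωt ∧ StrictConcaveOn ℝ Ωt ut ∧
    (∀ z ∈ Ωt, ∃! q : EuclideanSpace ℝ (Fin n) × EuclideanSpace ℝ (Fin n),
      q.1 ∈ Ω₀ ∧ q.2 ∈ Ω₁ ∧ z = (1 - t) • q.1 + t • q.2 ∧
      ut z = (1 - t) * u₀ q.1 + t * u₁ q.2 ∧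
      gradient ut z = gradient u₀ q.1 ∧ gradient u₀ q.1 = gradient u₁ q.2) ∧
    (∀ z ∈ Ωt, ∀ x ∈ Ω₀, ∀ y ∈ Ω₁,
      z = (1 - t) • x + t • y →
      ut z = (1 - t) * u₀ x + t * u₁ y →
      gradient ut z = gradient u₀ x → gradient u₀ x = gradient u₁ y →
      ∀ H₀ H₁ : EuclideanSpace ℝ (Fin n) →L[ℝ] EuclideanSpace ℝ (Fin n),
        HasFDerivAt (fun w => gradient u₀ w) H₀ x →
        (∀ h : EuclideanSpace ℝ (Fin n), h ≠ 0 → ⟪H₀ h, h⟫ < 0) →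
        HasFDerivAt (fun w => gradient u₁ w) H₁ y →
        (∀ h : EuclideanSpace ℝ (Fin n), h ≠ 0 → ⟪H₁ h, h⟫ < 0) →
        HasFDerivAt (fun w => gradient ut w)
          (((1 - t) • H₀.inverse + t • H₁.inverse).inverse) z) := by
  exact sc_main t ht Ω₀ Ω₁ h₀o h₀c h₁o h₁c u₀ u₁ hu₀1 hu₀cc hu₀lim hu₁1 hu₁cc hu₁lim Ωt hΩt ut hut
end

section
/- (Superadditivity of the p-Laplacian under sup-convolution.) Let p > 1. For i = 0, 1 let Ω_i ⊂ ℝⁿ be an open bounded convex set and u_i : Ω_i → ℝ a strictly concave C¹ function with u_i(x) → −∞ as x → ∂Ω_i. Fix t ∈ (0,1), set Ω_t = (1−t)Ω₀ + tΩ₁ and let ũ(z) = sup { (1−t)u₀(x) + t u₁(y) : x ∈ Ω₀, y ∈ Ω₁, z = (1−t)x + t y }. Let z ∈ Ω_t and let (x, y) ∈ Ω₀ × Ω₁ be the unique pair with z = (1−t)x + t y, ũ(z) = (1−t)u₀(x) + t u₁(y) and ∇ũ(z) = ∇u₀(x) = ∇u₁(y). If ∇ũ(z) ≠ 0, u₀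 is twice differentiable at x and u₁ at y with negative definite Hessians, then Δ_p ũ(z) ≥ (1−t) Δ_p u₀(x) + t Δ_p u₁(y). -/
open MeasureTheory Real Set Metric Bornology
open scoped RealInnerProductSpace Pointwise NNReal Topology

/-- The `p`-Laplacian of a twice differentiable function at a point with gradient `g ≠ 0`
and Hessian `H`: `Δ_p = ‖g‖^{p-2} (Δ + (p-2) ⟨H n, n⟩)` with `n = g/‖g‖`, `Δ = tr H`. -/
noncomputable def pLaplaceAt (n : ℕ) (p : ℝ) (g : EuclideanSpace ℝ (Fin n))
    (H : EuclideanSpace ℝ (Fin n) →L[ℝ] EuclideanSpace ℝ (Fin n)) : ℝ :=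
  ‖g‖ ^ (p - 2) *
    (LinearMap.trace ℝ (EuclideanSpace ℝ (Fin n))
        (H : EuclideanSpace ℝ (Fin n) →ₗ[ℝ] EuclideanSpace ℝ (Fin n))
      + (p - 2) * ⟪H (‖g‖⁻¹ • g), ‖g‖⁻¹ • g⟫)

open Filter in
lemma aux_second {φ ψ : ℝ → ℝ} {c : ℝ} (h1 : ∀ᶠ s in 𝓝 (0:ℝ), HasDerivAt φ (ψ s) s)
    (h0 : ψ 0 = 0) (h2 : HasDerivAt ψ c 0) (hmin : ∀ᶠ s in 𝓝 (0:ℝ), φ 0 ≤ φ s) : 0 ≤ c := by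
  by_contra hc
  push Not at hc
  have he : deriv φ =ᶠ[𝓝 0] ψ := h1.mono fun s hs => hs.deriv
  have hdd : deriv (deriv φ) 0 = c := by rw [he.deriv_eq]; exact h2.deriv
  have hmax : IsLocalMax φ 0 := isLocalMax_of_deriv_deriv_neg (by rw [hdd]; exact hc)
    (by rw [he.eq_of_nhds, h0]) h1.self_of_nhds.continuousAt
  have hconst : φ =ᶠ[𝓝 0] fun _ => φ 0 := by
    filter_upwards [hmin, hmax] with s a b using le_antisymm b a
  have h3 : deriv φ =ᶠ[𝓝 0] fun _ => (0:ℝ) := by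
    have := hconst.deriv
    simpa using this
  have h4 : deriv (deriv φ) 0 = 0 := by rw [h3.deriv_eq]; simp
  linarith

open Filter in
lemma aux_seg {n : ℕ} {u : EuclideanSpace ℝ (Fin n) → ℝ} {x : EuclideanSpace ℝ (Fin n)}
    {H : EuclideanSpace ℝ (Fin n) →L[ℝ] EuclideanSpace ℝ (Fin n)}
    (hd : ∀ᶠ w in 𝓝 x, DifferentiableAt ℝ u w)
    (hH : HasFDerivAt (fun w => gradient u w) H x) (h : EuclideanSpace ℝ (Fin n)) :
    (∀ᶠ s in 𝓝 (0:ℝ), HasDerivAt (fun s : ℝ => u (x + s • h)) ⟪gradient u (x + s • h), h⟫ s) ∧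
    HasDerivAt (fun s : ℝ => ⟪gradient u (x + s • h), h⟫) ⟪H h, h⟫ 0 := by
  have hl : ∀ s : ℝ, HasDerivAt (fun s : ℝ => x + s • h) h s := fun s => by
    simpa using ((hasDerivAt_id s).smul_const h).const_add x
  constructor
  · have ht : Tendsto (fun s : ℝ => x + s • h) (𝓝 0) (𝓝 x) := by
      have := (hl 0).continuousAt.tendsto
      simpa using this
    filter_upwards [ht.eventually hd] with s hs
    have h1 := hs.hasGradientAt.hasFDerivAt.comp_hasDerivAt s (hl s)
    simpa [Function.comp_def] using h1
  · have hH' : HasFDerivAt (fun w => gradient u w) H (x + (0:ℝ) • h) := by simpa using hH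
    have h1 := hH'.comp_hasDerivAt (0:ℝ) (hl 0)
    have h2 := h1.inner ℝ (hasDerivAt_const (0:ℝ) h)
    simpa [Function.comp_def] using h2

lemma aux_bdd {n : ℕ} {Ω : Set (EuclideanSpace ℝ (Fin n))} {u : EuclideanSpace ℝ (Fin n) → ℝ}
    (hu : ContinuousOn u Ω)
    (hlim : ∀ M : ℝ, ∃ K : Set (EuclideanSpace ℝ (Fin n)),
      IsCompact K ∧ K ⊆ Ω ∧ ∀ x ∈ Ω \ K, u x < -M) : ∃ C, ∀ x ∈ Ω, u x ≤ C := by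
  obtain ⟨K, hK, hKs, hKl⟩ := hlim 0
  obtain ⟨C, hC⟩ := hK.bddAbove_image (hu.mono hKs)
  refine ⟨max C 0, fun x hx => ?_⟩
  by_cases hxK : x ∈ K
  · exact le_max_of_le_left (hC ⟨x, hxK, rfl⟩)
  · have := hKl x ⟨hx, hxK⟩
    exact le_max_of_le_right (by linarith)

lemma aux_trace {n : ℕ} (D : EuclideanSpace ℝ (Fin n) →ₗ[ℝ] EuclideanSpace ℝ (Fin n))
    (hD : ∀ h, 0 ≤ ⟪D h, h⟫) (v : EuclideanSpace ℝ (Fin n)) (hv : ‖v‖ = 1) :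
    ⟪D v, v⟫ ≤ LinearMap.trace ℝ (EuclideanSpace ℝ (Fin n)) D := by
  have ho : Orthonormal ℝ ((↑) : ({v} : Set (EuclideanSpace ℝ (Fin n))) → EuclideanSpace ℝ (Fin n)) := by
    constructor
    · rintro ⟨w, rfl⟩; exact hv
    · rintro ⟨a, rfl⟩ ⟨b, rfl⟩ hab; exact absurd rfl hab
  obtain ⟨u, b, hvu, hb⟩ := ho.exists_orthonormalBasis_extension
  rw [LinearMap.trace_eq_sum_inner D b]
  have hvu' : v ∈ u := hvu rfl
  have := Finset.single_le_sum (f := fun i => ⟪b i, D (b i)⟫)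
    (fun i _ => by rw [real_inner_comm]; exact hD _) (Finset.mem_univ (⟨v, hvu'⟩ : u))
  simp only [hb] at this ⊢
  rw [real_inner_comm]
  exact this

/-- **Superadditivity of the `p`-Laplacian under sup-convolution**
(Lemma 5.2, i.e. Lemma 2.2 of Colesanti–Salani): at a point `z = (1-t)x + ty` of the
Minkowski combination realizing the sup-convolution `ũ`, with nonvanishing gradient and
negative definite Hessians of `u₀` at `x` and `u₁` at `y`,
`Δ_p ũ(z) ≥ (1-t) Δ_p u₀(x) + t Δ_p u₁(y)`. -/
theorem p_laplacian_superadditive_sup_convolution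
    (n : ℕ) (p : ℝ) (hp : 1 < p) (t : ℝ) (ht : t ∈ Set.Ioo (0 : ℝ) 1)
    (Ω₀ Ω₁ : Set (EuclideanSpace ℝ (Fin n)))
    (h₀o : IsOpen Ω₀) (h₀b : IsBounded Ω₀) (h₀c : Convex ℝ Ω₀)
    (h₁o : IsOpen Ω₁) (h₁b : IsBounded Ω₁) (h₁c : Convex ℝ Ω₁)
    (u₀ u₁ : EuclideanSpace ℝ (Fin n) → ℝ)
    (hu₀1 : ContDiffOn ℝ 1 u₀ Ω₀) (hu₀cc : StrictConcaveOn ℝ Ω₀ u₀)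
    (hu₀lim : ∀ M : ℝ, ∃ K : Set (EuclideanSpace ℝ (Fin n)),
      IsCompact K ∧ K ⊆ Ω₀ ∧ ∀ x ∈ Ω₀ \ K, u₀ x < -M)
    (hu₁1 : ContDiffOn ℝ 1 u₁ Ω₁) (hu₁cc : StrictConcaveOn ℝ Ω₁ u₁)
    (hu₁lim : ∀ M : ℝ, ∃ K : Set (EuclideanSpace ℝ (Fin n)),
      IsCompact K ∧ K ⊆ Ω₁ ∧ ∀ x ∈ Ω₁ \ K, u₁ x < -M)
    (Ωt : Set (EuclideanSpace ℝ (Fin n))) (hΩt : Ωt = (1 - t) • Ω₀ + t • Ω₁)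
    (ut : EuclideanSpace ℝ (Fin n) → ℝ)
    (hut : ∀ z, ut z = sSup {s : ℝ | ∃ x ∈ Ω₀, ∃ y ∈ Ω₁,
      z = (1 - t) • x + t • y ∧ s = (1 - t) * u₀ x + t * u₁ y})
    (z x y : EuclideanSpace ℝ (Fin n))
    (hz : z ∈ Ωt) (hx : x ∈ Ω₀) (hy : y ∈ Ω₁)
    (hzxy : z = (1 - t) • x + t • y)
    (hval : ut z = (1 - t) * u₀ x + t * u₁ y)
    (hgrad₀ : gradient ut z = gradient u₀ x) (hgrad₁ : gradient u₀ x = gradient u₁ y)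
    (hgne : gradient ut z ≠ 0)
    (H₀ H₁ Ht : EuclideanSpace ℝ (Fin n) →L[ℝ] EuclideanSpace ℝ (Fin n))
    (hH₀ : HasFDerivAt (fun w => gradient u₀ w) H₀ x)
    (hH₀neg : ∀ h : EuclideanSpace ℝ (Fin n), h ≠ 0 → ⟪H₀ h, h⟫ < 0)
    (hH₁ : HasFDerivAt (fun w => gradient u₁ w) H₁ y)
    (hH₁neg : ∀ h : EuclideanSpace ℝ (Fin n), h ≠ 0 → ⟪H₁ h, h⟫ < 0)
    (hHt : HasFDerivAt (fun w => gradient ut w) Ht z) :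
    (1 - t) * pLaplaceAt n p (gradient u₀ x) H₀ + t * pLaplaceAt n p (gradient u₁ y) H₁
      ≤ pLaplaceAt n p (gradient ut z) Ht := by
  obtain ⟨ht0, ht1⟩ := ht
  have hd₀ : ∀ᶠ w in 𝓝 x, DifferentiableAt ℝ u₀ w := by
    filter_upwards [h₀o.mem_nhds hx] with w hw
    exact (hu₀1.differentiableOn one_ne_zero).differentiableAt (h₀o.mem_nhds hw)
  have hd₁ : ∀ᶠ w in 𝓝 y, DifferentiableAt ℝ u₁ w := by
    filter_upwards [h₁o.mem_nhds hy] with w hw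
    exact (hu₁1.differentiableOn one_ne_zero).differentiableAt (h₁o.mem_nhds hw)
  have hdt : ∀ᶠ w in 𝓝 z, DifferentiableAt ℝ ut w := by
    filter_upwards [hHt.continuousAt.eventually_ne hgne] with w hw
    by_contra hc
    exact hw (gradient_eq_zero_of_not_differentiableAt hc)
  obtain ⟨C₀, hC₀⟩ := aux_bdd hu₀1.continuousOn hu₀lim
  obtain ⟨C₁, hC₁⟩ := aux_bdd hu₁1.continuousOn hu₁lim
  have hge : ∀ a ∈ Ω₀, ∀ b ∈ Ω₁, (1 - t) * u₀ a + t * u₁ b ≤ ut ((1 - t) • a + t • b) := by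
    intro a ha b hb
    rw [hut]
    refine le_csSup ⟨(1 - t) * C₀ + t * C₁, ?_⟩ ⟨a, ha, b, hb, rfl, rfl⟩
    rintro s ⟨a', ha', b', hb', -, rfl⟩
    have h1 := mul_le_mul_of_nonneg_left (hC₀ a' ha') (by linarith : 0 ≤ 1 - t)
    have h2 := mul_le_mul_of_nonneg_left (hC₁ b' hb') ht0.le
    linarith
  have hquad : ∀ h, 0 ≤ ⟪(Ht - (1 - t) • H₀ - t • H₁) h, h⟫ := by
    intro h
    obtain ⟨a0, b0⟩ := aux_seg hd₀ hH₀ h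
    obtain ⟨a1, b1⟩ := aux_seg hd₁ hH₁ h
    obtain ⟨a2, b2⟩ := aux_seg hdt hHt h
    have key := aux_second
      (φ := fun s : ℝ => ut (z + s • h) - (1 - t) * u₀ (x + s • h) - t * u₁ (y + s • h))
      (ψ := fun s : ℝ => ⟪gradient ut (z + s • h), h⟫ - (1 - t) * ⟪gradient u₀ (x + s • h), h⟫
        - t * ⟪gradient u₁ (y + s • h), h⟫)
      (c := ⟪Ht h, h⟫ - (1 - t) * ⟪H₀ h, h⟫ - t * ⟪H₁ h, h⟫)
      (by
        filter_upwards [a0, a1, a2] with s c0 c1 c2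
        exact (c2.sub (c0.const_mul (1 - t))).sub (c1.const_mul t))
      (by
        simp only [zero_smul, add_zero]
        rw [hgrad₀, ← hgrad₁]; ring)
      ((b2.sub (b0.const_mul (1 - t))).sub (b1.const_mul t))
      (by
        have hc : ∀ q : EuclideanSpace ℝ (Fin n),
            Filter.Tendsto (fun s : ℝ => q + s • h) (𝓝 0) (𝓝 q) := by
          intro q
          have : Continuous (fun s : ℝ => q + s • h) := by fun_prop
          simpa using this.tendsto 0
        filter_upwards [(hc x).eventually (h₀o.mem_nhds hx),
          (hc y).eventually (h₁o.mem_nhds hy)] with s m0 m1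
        have h3 := hge _ m0 _ m1
        have h4 : (1 - t) • (x + s • h) + t • (y + s • h) = z + s • h := by
          rw [hzxy]; module
        rw [h4] at h3
        simp only [zero_smul, add_zero]
        rw [hval]
        linarith)
    simpa [inner_sub_left, inner_smul_left] using key
  rw [← hgrad₁, ← hgrad₀]
  set g := gradient ut z with hg
  have hv : ‖(‖g‖⁻¹ • g)‖ = 1 := by
    rw [norm_smul, norm_inv, norm_norm, inv_mul_cancel₀ (norm_ne_zero_iff.mpr hgne)]
  unfold pLaplaceAt
  set v := ‖g‖⁻¹ • g with hvdef
  have htr := aux_trace ((Ht - (1 - t) • H₀ - t • H₁ :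
    EuclideanSpace ℝ (Fin n) →L[ℝ] EuclideanSpace ℝ (Fin n)) :
    EuclideanSpace ℝ (Fin n) →ₗ[ℝ] EuclideanSpace ℝ (Fin n)) hquad v hv
  have hq := hquad v
  have hpos : 0 ≤ ‖g‖ ^ (p - 2) := by positivity
  simp only [ContinuousLinearMap.toLinearMap_sub, ContinuousLinearMap.toLinearMap_smul, map_sub,
    map_smul, smul_eq_mul, LinearMap.sub_apply, LinearMap.smul_apply,
    ContinuousLinearMap.coe_coe, ContinuousLinearMap.sub_apply, ContinuousLinearMap.smul_apply,
    inner_sub_left, real_inner_smul_left] at htr hq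
  have h5 := mul_nonneg (by linarith : 0 ≤ p - 1) hq
  have h6 := mul_nonneg hpos (add_nonneg h5 (sub_nonneg.mpr htr))
  linarith
end
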